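/- Let ℓ₁, ℓ₂, ℓ₃ > 0 be arbitrary positive reals and let Θ = Θ(ℓ₁,ℓ₂,ℓ₃) be the theta space with segment lengths ℓ₁, ℓ₂, ℓ₃. Then Θ does not have negative type: there exists a finitely supported function ω : Θ → ℝ with ∑_x ω(x) = 0 and ∑_{x,y} ω(x)ω(y) d(x,y) > 0. -/

import Mathlib

/-- Given two distinct indices in `Fin 3`, the remaining index. -/
def thetaOther (i j : Fin 3) : Fin 3 := if j = i + 1 then i + 2 else i + 1

/-- The shortest-path distance on the theta space `Θ(ℓ 0, ℓ 1, ℓ 2)`, expressed on raw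
coordinates: a point `(i, s)` is the point at distance `s` from `u` along the `i`-th
segment (of length `ℓ i`), where all points `(i, 0)` are identified to a single
point `u` and all points `(i, ℓ i)` are identified to a single point `v`. -/
noncomputable def thetaDist (ℓ : Fin 3 → ℝ) (p q : Fin 3 × ℝ) : ℝ :=
  if p.1 = q.1 then
    min |p.2 - q.2|
      (min (p.2 + q.2 + min (ℓ (p.1 + 1)) (ℓ (p.1 + 2)))
        ((ℓ p.1 - p.2) + (ℓ p.1 - q.2) + min (ℓ (p.1 + 1)) (ℓ (p.1 + 2))))
  else
    min (p.2 + q.2)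
      (min ((ℓ p.1 - p.2) + (ℓ q.1 - q.2))
        (min (p.2 + ℓ (thetaOther p.1 q.1) + (ℓ q.1 - q.2))
          ((ℓ p.1 - p.2) + ℓ (thetaOther p.1 q.1) + q.2)))

/-- `(i, s)` is a valid coordinate for a point of the theta space `Θ(ℓ 0, ℓ 1, ℓ 2)`. -/
def IsThetaPoint (ℓ : Fin 3 → ℝ) (p : Fin 3 × ℝ) : Prop :=
  0 ≤ p.2 ∧ p.2 ≤ ℓ p.1

/-- Canonical representatives of the points of the theta space `Θ(ℓ 0, ℓ 1, ℓ 2)`: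
every point of the theta space has exactly one canonical coordinate representative,
the two branch vertices `u, v` being represented on segment `0`. -/
def IsThetaRep (ℓ : Fin 3 → ℝ) (p : Fin 3 × ℝ) : Prop :=
  IsThetaPoint ℓ p ∧ (p.2 = 0 → p.1 = 0) ∧ (p.2 = ℓ p.1 → p.1 = 0)

lemma thetaOther_comm {i j : Fin 3} (h : i ≠ j) : thetaOther i j = thetaOther j i := by
  revert i j; decide

lemma thetaDist_comm (ℓ : Fin 3 → ℝ) (p q : Fin 3 × ℝ) :
    thetaDist ℓ p q = thetaDist ℓ q p := by
  obtain ⟨i, s⟩ := p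
  obtain ⟨j, t⟩ := q
  unfold thetaDist
  by_cases h : i = j
  · subst h
    simp only [if_true, abs_sub_comm s t, add_comm s t, add_comm (ℓ i - s)]
  · simp only [if_neg h, if_neg (Ne.symm h), thetaOther_comm h]
    rw [add_comm s t, add_comm (ℓ i - s) (ℓ j - t),
      min_comm (s + ℓ (thetaOther j i) + (ℓ j - t))]
    congr 3 <;> ring

/-- On a single segment, `thetaDist` is the distance along that segment. -/
lemma thetaDist_same {ℓ : Fin 3 → ℝ} (hℓ : ∀ i, 0 < ℓ i) {i : Fin 3} {s t : ℝ}
    (hs : 0 ≤ s) (hs' : s ≤ ℓ i) (ht : 0 ≤ t) (ht' : t ≤ ℓ i) :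
    thetaDist ℓ (i, s) (i, t) = |s - t| := by
  have hm : 0 < min (ℓ (i + 1)) (ℓ (i + 2)) := lt_min (hℓ _) (hℓ _)
  simp only [thetaDist, if_true]
  refine min_eq_left (le_min ?_ ?_) <;> rw [abs_le] <;> constructor <;> linarith

lemma thetaDist_of_ne (ℓ : Fin 3 → ℝ) {i j k : Fin 3} (hij : i ≠ j) (hik : i ≠ k)
    (hjk : j ≠ k) (s t : ℝ) :
    thetaDist ℓ (i, s) (j, t) =
      min (s + t) (min ((ℓ i - s) + (ℓ j - t))
        (min (s + ℓ k + (ℓ j - t)) ((ℓ i - s) + ℓ k + t))) := by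
  have hk : thetaOther i j = k := by revert i j k; decide
  simp only [thetaDist, if_neg hij, hk]

lemma exists_ne_ne {i j : Fin 3} : ∃ k, i ≠ k ∧ j ≠ k := by
  revert i j; decide

lemma eq_or_eq_or_eq {i j k : Fin 3} (hij : i ≠ j) (hik : i ≠ k) (hjk : j ≠ k) (l : Fin 3) :
    l = i ∨ l = j ∨ l = k := by
  revert i j k l; decide

lemma thetaDist_mid_mid {ℓ : Fin 3 → ℝ} (hℓ : ∀ i, 0 < ℓ i) {i j : Fin 3} (h : i ≠ j) :
    thetaDist ℓ (i, ℓ i / 2) (j, ℓ j / 2) = (ℓ i + ℓ j) / 2 := by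
  obtain ⟨k, hik, hjk⟩ := @exists_ne_ne i j
  have := hℓ k
  rw [thetaDist_of_ne ℓ h hik hjk, min_eq_left]
  · ring
  · refine le_min ?_ (le_min ?_ ?_) <;> linarith

lemma thetaDist_start_mid {ℓ : Fin 3 → ℝ} (hℓ : ∀ i, 0 < ℓ i) (i j : Fin 3) :
    thetaDist ℓ (i, 0) (j, ℓ j / 2) = ℓ j / 2 := by
  have hi := hℓ i
  have hj := hℓ j
  by_cases h : i = j
  · subst h
    rw [thetaDist_same hℓ le_rfl hi.le (by linarith) (by linarith), abs_of_nonpos] <;> linarith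
  · obtain ⟨k, hik, hjk⟩ := @exists_ne_ne i j
    have := hℓ k
    rw [thetaDist_of_ne ℓ h hik hjk, min_eq_left]
    · ring
    · refine le_min ?_ (le_min ?_ ?_) <;> linarith

lemma thetaDist_end_mid {ℓ : Fin 3 → ℝ} (hℓ : ∀ i, 0 < ℓ i) (i j : Fin 3) :
    thetaDist ℓ (i, ℓ i) (j, ℓ j / 2) = ℓ j / 2 := by
  have hi := hℓ i
  have hj := hℓ j
  by_cases h : i = j
  · subst h
    rw [thetaDist_same hℓ hi.le le_rfl (by linarith) (by linarith), abs_of_nonneg] <;> linarith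
  · obtain ⟨k, hik, hjk⟩ := @exists_ne_ne i j
    have := hℓ k
    rw [thetaDist_of_ne ℓ h hik hjk, min_eq_right, min_eq_left]
    · ring
    · refine le_min ?_ ?_ <;> linarith
    · exact (min_le_left _ _).trans (by linarith)

lemma isThetaRep_mid {ℓ : Fin 3 → ℝ} (hℓ : ∀ i, 0 < ℓ i) (i : Fin 3) :
    IsThetaRep ℓ (i, ℓ i / 2) := by
  have := hℓ i
  refine ⟨⟨?_, ?_⟩, fun h => ?_, fun h => ?_⟩ <;> dsimp only at * <;> linarith

lemma thetaDist_self {ℓ : Fin 3 → ℝ} (hℓ : ∀ i, 0 < ℓ i) {p : Fin 3 × ℝ}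
    (hp : IsThetaRep ℓ p) : thetaDist ℓ p p = 0 := by
  rw [← Prod.mk.eta (p := p), thetaDist_same hℓ hp.1.1 hp.1.2 hp.1.1 hp.1.2, sub_self, abs_zero]

/-- A weighted finite family of points gives a finitely supported function with the same
total mass and the same energy; points of the family may coincide. -/
lemma exists_finsupp_of_family {α ι : Type*} [Fintype ι] (S : α → Prop) (d : α → α → ℝ)
    (P : ι → α) (w : ι → ℝ) (hP : ∀ i, S (P i)) :
    ∃ ω : α →₀ ℝ, (∀ p ∈ ω.support, S p) ∧ (∑ x ∈ ω.support, ω x) = ∑ i, w i ∧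
      ∑ x ∈ ω.support, ∑ y ∈ ω.support, ω x * ω y * d x y =
        ∑ i, ∑ j, w i * w j * d (P i) (P j) := by
  classical
  set ω : α →₀ ℝ := ∑ i, Finsupp.single (P i) (w i) with hω
  have key (f : α → ℝ) : ∑ x ∈ ω.support, ω x * f x = ∑ i, w i * f (P i) := by
    have h : Finsupp.linearCombination ℝ f ω = ∑ i, w i * f (P i) := by
      simp [hω, map_sum, Finsupp.linearCombination_single]
    simpa [Finsupp.linearCombination_apply, Finsupp.sum] using h
  refine ⟨ω, fun p hp => ?_, by simpa using key fun _ => 1, ?_⟩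
  · obtain ⟨i, -, hi⟩ := Finset.mem_biUnion.1 (Finsupp.support_finsetSum hp)
    rw [Finset.mem_singleton.1 (Finsupp.support_single_subset hi)]
    exact hP i
  · simp only [mul_assoc, ← Finset.mul_sum, key]

/-- The point antipodal to `u` on the cycle formed by the two shortest segments `i`, `j`.
The distance from `u` is only bounded below, since `thetaDist` measures along a segment
whenever both points are represented on it. -/
lemma exists_antipode {ℓ : Fin 3 → ℝ} (hℓ : ∀ i, 0 < ℓ i) {i j k : Fin 3} (hij : i ≠ j)
    (hik : i ≠ k) (hjk : j ≠ k) (h₁ : ℓ i ≤ ℓ j) (h₂ : ℓ j ≤ ℓ k) :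
    ∃ W, IsThetaRep ℓ W ∧ (ℓ i + ℓ j) / 2 ≤ thetaDist ℓ (0, 0) W ∧
      thetaDist ℓ W (i, ℓ i / 2) = ℓ j / 2 ∧ thetaDist ℓ W (j, ℓ j / 2) = ℓ i / 2 ∧
      thetaDist ℓ W (k, ℓ k / 2) = (ℓ k + ℓ j - ℓ i) / 2 := by
  have hi := hℓ i
  have hj := hℓ j
  have hk := hℓ k
  rcases h₁.eq_or_lt with h | h
  · have h0 := hℓ 0
    refine ⟨(0, ℓ 0), ⟨⟨h0.le, le_rfl⟩, fun _ => rfl, fun _ => rfl⟩, ?_, ?_, ?_, ?_⟩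
    · rw [thetaDist_same hℓ le_rfl h0.le h0.le le_rfl, zero_sub, abs_neg, abs_of_pos h0]
      have : ℓ i ≤ ℓ 0 := by
        rcases eq_or_eq_or_eq hij hik hjk 0 with e | e | e <;> rw [e] <;> linarith
      linarith
    all_goals rw [thetaDist_end_mid hℓ]; linarith
  · refine ⟨(j, (ℓ i + ℓ j) / 2), ⟨⟨?_, ?_⟩, fun e => ?_, fun e => ?_⟩, ?_, ?_, ?_, ?_⟩
    iterate 4 dsimp only at *; linarith
    · rcases eq_or_eq_or_eq hij hik hjk 0 with e | e | e <;> rw [e]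
      · rw [thetaDist_of_ne ℓ hij hik hjk]
        refine le_min ?_ (le_min ?_ (le_min ?_ ?_)) <;> linarith
      · rw [thetaDist_same hℓ le_rfl hj.le (by linarith) (by linarith), zero_sub, abs_neg]
        exact le_abs_self _
      · rw [thetaDist_of_ne ℓ hjk.symm hik.symm hij.symm]
        refine le_min ?_ (le_min ?_ (le_min ?_ ?_)) <;> linarith
    · rw [thetaDist_of_ne ℓ hij.symm hjk hik, min_eq_right, min_eq_left]
      · ring
      · refine le_min ?_ ?_ <;> linarith
      · exact (min_le_left _ _).trans (by linarith)
    · rw [thetaDist_same hℓ (by linarith) (by linarith) (by linarith) (by linarith),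
        abs_of_nonneg] <;> linarith
    · rw [thetaDist_of_ne ℓ hjk hij.symm hik.symm, min_eq_right, min_eq_left]
      · ring
      · refine le_min ?_ ?_ <;> linarith
      · exact (min_le_left _ _).trans (by linarith)

/-- a theta space with arbitrary positive segment lengths does not have
negative type: there is a finitely supported function `ω` on its points (given by
their canonical representatives) with total sum `0` and positive energy
`∑ ω(x) ω(y) d(x,y)`. -/
theorem theta_not_negative_type_pos_lengths (ℓ : Fin 3 → ℝ) (hℓ : ∀ i, 0 < ℓ i) :
    ∃ ω : (Fin 3 × ℝ) →₀ ℝ,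
      (∀ p ∈ ω.support, IsThetaRep ℓ p) ∧
      (∑ x ∈ ω.support, ω x) = 0 ∧
      0 < ∑ x ∈ ω.support, ∑ y ∈ ω.support, ω x * ω y * thetaDist ℓ x y := by
  obtain ⟨i, j, k, hij, hik, hjk, h₁, h₂⟩ : ∃ i j k : Fin 3,
      i ≠ j ∧ i ≠ k ∧ j ≠ k ∧ ℓ i ≤ ℓ j ∧ ℓ j ≤ ℓ k := by
    have hσ := Tuple.monotone_sort ℓ
    have inj := (Tuple.sort ℓ).injective
    exact ⟨Tuple.sort ℓ 0, Tuple.sort ℓ 1, Tuple.sort ℓ 2, inj.ne (by decide),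
      inj.ne (by decide), inj.ne (by decide), hσ (by decide : (0 : Fin 3) ≤ 1),
      hσ (by decide : (1 : Fin 3) ≤ 2)⟩
  obtain ⟨W, hW, hUW, hWi, hWj, hWk⟩ := exists_antipode hℓ hij hik hjk h₁ h₂
  have hU : IsThetaRep ℓ (0, 0) := ⟨⟨le_rfl, (hℓ 0).le⟩, fun _ => rfl, fun _ => rfl⟩
  have hM := isThetaRep_mid hℓ
  obtain ⟨ω, hS, hsum, hE⟩ := exists_finsupp_of_family (IsThetaRep ℓ) (thetaDist ℓ)
    ![(0, 0), W, (i, ℓ i / 2), (j, ℓ j / 2), (k, ℓ k / 2)]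
    ![-(ℓ k + ℓ i), -ℓ k, ℓ k, ℓ k, ℓ i] (by
      intro n
      fin_cases n
      exacts [hU, hW, hM i, hM j, hM k])
  refine ⟨ω, hS, ?_, ?_⟩
  · rw [hsum, Fin.sum_univ_five]
    simp
  · rw [hE]
    simp only [Fin.sum_univ_five, Matrix.cons_val]
    rw [thetaDist_comm ℓ W (0, 0), thetaDist_comm ℓ (i, _) W, thetaDist_comm ℓ (j, _) W,
      thetaDist_comm ℓ (k, _) W, thetaDist_comm ℓ (i, _) (0, 0), thetaDist_comm ℓ (j, _) (0, 0),
      thetaDist_comm ℓ (k, _) (0, 0)]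
    simp only [thetaDist_self hℓ hU, thetaDist_self hℓ hW, thetaDist_self hℓ (hM _),
      thetaDist_start_mid hℓ, hWi, hWj, hWk, thetaDist_mid_mid hℓ hij, thetaDist_mid_mid hℓ hik,
      thetaDist_mid_mid hℓ hjk, thetaDist_mid_mid hℓ hij.symm, thetaDist_mid_mid hℓ hik.symm,
      thetaDist_mid_mid hℓ hjk.symm]
    have hi := hℓ i
    have hk := hℓ k
    have hgain : 0 < ℓ k * ℓ i ^ 2 := by positivity
    have hbound := mul_le_mul_of_nonneg_left hUW (by positivity : 0 ≤ (ℓ k + ℓ i) * ℓ k)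
    linarith
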